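/- For the β-biased random walk (β > 1) started at (d,1) on the trap with anchor (d,0), entrance length e and core length c, the probability that the walk visits the core vertex (d−e,2) before visiting the anchor (d,0) equals (β−1)/(β^{e+1}+β−2). -/

import Mathlib

open MeasureTheory Filter
open scoped ENNReal

noncomputable section

/-- Vertices of the square lattice. -/
abbrev V : Type := ℤ × ℤ

/-- Adjacency in the square lattice ℤ²: Euclidean distance one. -/
def latAdj (u v : V) : Prop := (u.1 - v.1) ^ 2 + (u.2 - v.2) ^ 2 = 1

instance : MeasurableSpace (Sym2 V) := ⊤

open scoped Classical in
/-- One-step transition probability of the β-biased random walk on the subgraph of ℤ²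
with edge set `G`: if the set `Λ` of neighbours of `z` is nonempty and contains the right
neighbour `(z.1+1, z.2)`, step to it with probability `β/(β+|Λ|-1)` and to each other
neighbour with probability `1/(β+|Λ|-1)`; if `Λ` does not contain the right neighbour, step
uniformly in `Λ`; if `Λ` is empty, stay put. -/
def transProb (β : ℝ) (G : Set (Sym2 V)) (z w : V) : ℝ :=
  if {u : V | s(z, u) ∈ G} = ∅ then (if w = z then 1 else 0)
  else
    if s(z, w) ∈ G then
      (if s(z, ((z.1 + 1, z.2) : V)) ∈ G then
        (if w = ((z.1 + 1, z.2) : V) then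
          β / (β + ({u : V | s(z, u) ∈ G}.ncard : ℝ) - 1)
        else 1 / (β + ({u : V | s(z, u) ∈ G}.ncard : ℝ) - 1))
      else 1 / ({u : V | s(z, u) ∈ G}.ncard : ℝ))
    else 0

/-- `μ` is the law of the β-biased random walk on the subgraph of ℤ² with edge set `G`,
started at `z₀`: a probability measure on trajectories whose cylinder probabilities are
the products of the one-step transition probabilities. -/
def IsWalkLaw (β : ℝ) (G : Set (Sym2 V)) (z₀ : V) (μ : Measure (ℕ → V)) : Prop :=
  IsProbabilityMeasure μ ∧
    ∀ (n : ℕ) (f : ℕ → V), f 0 = z₀ →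
      μ {ω | ∀ i ≤ n, ω i = f i} =
        ENNReal.ofReal (∏ i ∈ Finset.range n, transProb β G (f i) (f (i + 1)))

/-- The trap with anchor `(d, y)`, entrance length `e` (at height `y+1`, running leftward
from the anchor) and core length `c` (at height `y+2`, running rightward). -/
def trapEdgesAt (d y : ℤ) (e c : ℕ) : Set (Sym2 V) :=
  {s((d, y), (d, y + 1)), s((d - e, y + 1), (d - e, y + 2))} ∪
    {f | ∃ i : ℕ, i < e ∧ f = s((d - e + i, y + 1), (d - e + i + 1, y + 1))} ∪
    {f | ∃ i : ℕ, i < c ∧ f = s((d - e + i, y + 2), (d - e + i + 1, y + 2))}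

/-- The walk visits `a` before any visit to `b`. -/
def VisitsBefore (ω : ℕ → V) (a b : V) : Prop :=
  ∃ t : ℕ, ω t = a ∧ ∀ s ≤ t, ω s ≠ b

/-- The trajectories that sit in `K` at all times `< n` and at `v` at time `n`. -/
def stayThenAt (K : Set V) (n : ℕ) (v : V) : Set (ℕ → V) :=
  {ω | ω n = v ∧ ∀ s < n, ω s ∈ K}

lemma measurableSet_coord_eq (n : ℕ) (v : V) : MeasurableSet {ω : ℕ → V | ω n = v} :=
  (measurable_pi_apply (X := fun _ => V) n) (measurableSet_singleton v)

lemma measurableSet_stayThenAt (K : Set V) (n : ℕ) (v : V) :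
    MeasurableSet (stayThenAt K n v) := by
  have : stayThenAt K n v = {ω : ℕ → V | ω n = v} ∩ ⋂ s, ⋂ (_ : s < n), {ω : ℕ → V | ω s ∈ K} := by
    ext ω
    simp [stayThenAt]
  rw [this]
  refine (measurableSet_coord_eq n v).inter (.iInter fun s => .iInter fun _ => ?_)
  exact (measurable_pi_apply (X := fun _ => V) s) K.to_countable.measurableSet

lemma transProb_nonneg {β : ℝ} (hβ : 1 ≤ β) (G : Set (Sym2 V)) (z w : V) :
    0 ≤ transProb β G z w := by
  have h : 0 ≤ β + ({u : V | s(z, u) ∈ G}.ncard : ℝ) - 1 := by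
    have : (0 : ℝ) ≤ ({u : V | s(z, u) ∈ G}.ncard : ℝ) := by positivity
    linarith
  have h0 : 0 ≤ β := by linarith
  unfold transProb
  split_ifs <;> positivity

section WalkLaw

variable {β : ℝ} {G : Set (Sym2 V)} {z₀ : V} {μ : Measure (ℕ → V)}

lemma IsWalkLaw.measure_start (hμ : IsWalkLaw β G z₀ μ) : μ {ω | ω 0 = z₀} = 1 := by
  simpa using hμ.2 0 (fun _ => z₀) rfl

lemma IsWalkLaw.measure_start_ne (hμ : IsWalkLaw β G z₀ μ) : μ {ω | ω 0 ≠ z₀} = 0 := by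
  have := hμ.1
  exact (prob_compl_eq_zero_iff (measurableSet_coord_eq 0 z₀)).2 hμ.measure_start

lemma IsWalkLaw.measure_cylinder_succ (hμ : IsWalkLaw β G z₀ μ) (hβ : 1 ≤ β) (n : ℕ)
    (f : ℕ → V) :
    μ {ω | ∀ i ≤ n + 1, ω i = f i} =
      μ {ω | ∀ i ≤ n, ω i = f i} * ENNReal.ofReal (transProb β G (f n) (f (n + 1))) := by
  by_cases h0 : f 0 = z₀
  · rw [hμ.2 _ f h0, hμ.2 _ f h0, Finset.prod_range_succ, ENNReal.ofReal_mul]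
    exact Finset.prod_nonneg fun i _ => transProb_nonneg hβ _ _ _
  · have key : ∀ m, μ {ω | ∀ i ≤ m, ω i = f i} = 0 := fun m =>
      measure_mono_null (fun ω hω => by simpa [hω 0 (Nat.zero_le m)] using h0)
        hμ.measure_start_ne
    rw [key, key, zero_mul]

/-- The Markov property for events depending on the first `n + 1` positions. -/
lemma IsWalkLaw.measure_history_inter (hμ : IsWalkLaw β G z₀ μ) (hβ : 1 ≤ β) (n : ℕ) (v w : V)
    (B : Set (Fin (n + 1) → V)) (hB : ∀ h ∈ B, h (Fin.last n) = v) :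
    μ ((fun (ω : ℕ → V) (i : Fin (n + 1)) => ω i) ⁻¹' B ∩ {ω | ω (n + 1) = w}) =
      μ ((fun (ω : ℕ → V) (i : Fin (n + 1)) => ω i) ⁻¹' B) * ENNReal.ofReal (transProb β G v w) := by
  set r : (ℕ → V) → (Fin (n + 1) → V) := fun ω i => ω i with hr
  have hrm : Measurable r := measurable_pi_lambda _ fun i => measurable_pi_apply _
  have hfib : ∀ y ∈ B, MeasurableSet (r ⁻¹' {y}) := fun y _ => hrm (measurableSet_singleton y)
  rw [← Measure.restrict_apply (hrm B.to_countable.measurableSet),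
    ← tsum_measure_preimage_singleton B.to_countable hfib,
    ← tsum_measure_preimage_singleton B.to_countable hfib, ← ENNReal.tsum_mul_right]
  refine tsum_congr fun h => ?_
  rw [Measure.restrict_apply (hfib h h.2)]
  let f : ℕ → V := fun i => if hi : i < n + 1 then h.1 ⟨i, hi⟩ else w
  have hfh : ∀ i : Fin (n + 1), f i = h.1 i := fun i => dif_pos i.2
  have hfn : f n = v := (hfh (Fin.last n)).trans (hB h h.2)
  have hfn' : f (n + 1) = w := by simp [f]
  have h1 : r ⁻¹' {h.1} = {ω | ∀ i ≤ n, ω i = f i} := by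
    ext ω
    simp only [Set.mem_preimage, Set.mem_singleton_iff, Set.mem_ofPred_eq, funext_iff]
    constructor
    · intro H i hi
      exact (H ⟨i, Nat.lt_succ_of_le hi⟩).trans (hfh ⟨i, Nat.lt_succ_of_le hi⟩).symm
    · intro H i
      exact (H i (Nat.le_of_lt_succ i.2)).trans (hfh i)
  have h2 : {ω : ℕ → V | ∀ i ≤ n, ω i = f i} ∩ {ω | ω (n + 1) = w} =
      {ω | ∀ i ≤ n + 1, ω i = f i} := by
    ext ω
    simp only [Set.mem_inter_iff, Set.mem_ofPred_eq, Nat.le_succ_iff, or_imp, forall_and,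
      forall_eq, hfn', Nat.succ_eq_add_one]
  rw [h1, h2, hμ.measure_cylinder_succ hβ, hfn, hfn']

lemma IsWalkLaw.measureReal_stayThenAt_inter (hμ : IsWalkLaw β G z₀ μ) (hβ : 1 ≤ β)
    (K : Set V) (n : ℕ) (v w : V) :
    μ.real (stayThenAt K n v ∩ {ω | ω (n + 1) = w}) =
      μ.real (stayThenAt K n v) * transProb β G v w := by
  have h := hμ.measure_history_inter hβ n v w
    {h | h (Fin.last n) = v ∧ ∀ s : Fin (n + 1), (s : ℕ) < n → h s ∈ K} fun h hh => hh.1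
  have hT : (fun (ω : ℕ → V) (i : Fin (n + 1)) => ω i) ⁻¹'
      {h | h (Fin.last n) = v ∧ ∀ s : Fin (n + 1), (s : ℕ) < n → h s ∈ K} =
      stayThenAt K n v := by
    ext ω
    simp only [Set.mem_preimage, Set.mem_ofPred_eq, stayThenAt, Fin.val_last]
    exact and_congr_right fun _ =>
      ⟨fun H s hs => H ⟨s, by omega⟩ hs, fun H s hs => H s hs⟩
  rw [hT] at h
  rw [measureReal_def, h, ENNReal.toReal_mul, ENNReal.toReal_ofReal (transProb_nonneg hβ _ _ _),
    measureReal_def]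

/-- Decomposition of `stayThenAt` at the last step over the position in the finite set
`p '' I` just before it. -/
lemma IsWalkLaw.measureReal_stayThenAt_succ (hμ : IsWalkLaw β G z₀ μ) (hβ : 1 ≤ β)
    {p : ℕ → V} {I : Finset ℕ} (hp : Set.InjOn p I) (n : ℕ) (w : V) :
    μ.real (stayThenAt (p '' I) (n + 1) w) =
      ∑ i ∈ I, μ.real (stayThenAt (p '' I) n (p i)) * transProb β G (p i) w := by
  have := hμ.1
  have hU : stayThenAt (p '' I) (n + 1) w =
      ⋃ i ∈ I, stayThenAt (p '' I) n (p i) ∩ {ω | ω (n + 1) = w} := by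
    ext ω
    simp only [stayThenAt, Set.mem_ofPred_eq, Set.mem_iUnion, Set.mem_inter_iff, exists_prop]
    constructor
    · rintro ⟨hw, H⟩
      obtain ⟨i, hi, hin⟩ := H n (Nat.lt_succ_self n)
      exact ⟨i, hi, ⟨hin.symm, fun s hs => H s (by omega)⟩, hw⟩
    · rintro ⟨i, hi, ⟨hin, H⟩, hw⟩
      refine ⟨hw, fun s hs => ?_⟩
      rcases Nat.lt_succ_iff_lt_or_eq.1 hs with h | rfl
      · exact H s h
      · exact ⟨i, hi, hin.symm⟩
  rw [hU, measureReal_biUnion_finset]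
  · exact Finset.sum_congr rfl fun i _ => hμ.measureReal_stayThenAt_inter hβ _ n _ w
  · intro i hi j hj hij
    refine Set.disjoint_left.2 fun ω h1 h2 => hij (hp hi hj ?_)
    exact h1.1.1.symm.trans h2.1.1
  · exact fun i _ => (measurableSet_stayThenAt _ _ _).inter (measurableSet_coord_eq _ _)

/-- Visits to `a` after a stay in `K`, which misses `a` and `b`, are visits before `b`. -/
lemma sum_measureReal_stayThenAt_le [IsProbabilityMeasure μ] {K : Set V} {a b : V}
    (ha : a ∉ K) (hb : b ∉ K) (hab : a ≠ b) (n : ℕ) :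
    ∑ m ∈ Finset.range n, μ.real (stayThenAt K m a) ≤ μ.real {ω | VisitsBefore ω a b} := by
  rw [← measureReal_biUnion_finset]
  · refine measureReal_mono fun ω hω => ?_
    simp only [Set.mem_iUnion, exists_prop] at hω
    obtain ⟨m, -, hm, H⟩ := hω
    refine ⟨m, hm, fun s hs hsb => ?_⟩
    rcases hs.lt_or_eq with h | rfl
    · exact hb (hsb ▸ H s h)
    · exact hab (hm.symm.trans hsb)
  · intro i _ j _ hij
    refine Set.disjoint_left.2 fun ω h1 h2 => ?_
    rcases lt_or_gt_of_ne hij with h | h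
    · exact ha (h1.1 ▸ h2.2 i h)
    · exact ha (h2.1 ▸ h1.2 j h)
  · exact fun i _ => measurableSet_stayThenAt _ _ _

end WalkLaw

lemma measurableSet_visitsBefore (a b : V) : MeasurableSet {ω | VisitsBefore ω a b} := by
  have : {ω | VisitsBefore ω a b} =
      ⋃ t, {ω : ℕ → V | ω t = a} ∩ ⋂ s, ⋂ (_ : s ≤ t), {ω : ℕ → V | ω s = b}ᶜ := by
    ext ω
    simp [VisitsBefore]
  rw [this]
  exact .iUnion fun t => (measurableSet_coord_eq t a).inter
    (.iInter fun s => .iInter fun _ => (measurableSet_coord_eq s b).compl)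

lemma disjoint_visitsBefore (a b : V) :
    Disjoint {ω | VisitsBefore ω a b} {ω | VisitsBefore ω b a} := by
  refine Set.disjoint_left.2 fun ω => ?_
  rintro ⟨t, hta, ht⟩ ⟨s, hsb, hs⟩
  rcases le_total s t with h | h
  · exact ht s h hsb
  · exact hs t h hta

/-- A nonnegative function `g` that decreases on average by a fixed amount while in the interior
forces the mass left in the interior to vanish. -/
lemma tendsto_zero_of_drift {S g : ℕ → ℝ} {δ : ℝ} (hδ : 0 < δ) (hS : ∀ n, 0 ≤ S n)
    (hg : ∀ n, 0 ≤ g n) (h : ∀ n, g (n + 1) + δ * S n ≤ g n) : Tendsto S atTop (nhds 0) := by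
  have hb : ∀ n, g n + δ * ∑ m ∈ Finset.range n, S m ≤ g 0 := by
    intro n
    induction n with
    | zero => simp
    | succ n ih =>
      rw [Finset.sum_range_succ]
      linarith [h n]
  refine (summable_of_sum_range_le (c := g 0 / δ) hS fun n => ?_).tendsto_atTop_zero
  rw [le_div_iff₀ hδ]
  linarith [hb n, hg n]

/-- Ruin probabilities for a walk on `{0, …, N + 1}` killed at the two ends, whose interior steps
go up with probability `q i` and down with probability `1 - q i`, started at `1`. Here `x n j` is
the probability of being at `j` at time `n` for the first time if `j` is an end. -/
lemma tendsto_ruin {N : ℕ} (hN : 1 ≤ N) {x : ℕ → ℕ → ℝ} {P : ℕ → ℕ → ℝ} {q h g : ℕ → ℝ} {δ : ℝ}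
    (hx : ∀ n j, 0 ≤ x n j) (hx1 : x 0 1 = 1) (hx0 : ∀ j, j ≠ 1 → x 0 j = 0)
    (hrec : ∀ n, ∀ j ≤ N + 1, x (n + 1) j = ∑ i ∈ Finset.Icc 1 N, x n i * P i j)
    (hup : ∀ i ∈ Finset.Icc 1 N, P i (i + 1) = q i)
    (hdown : ∀ i ∈ Finset.Icc 1 N, P i (i - 1) = 1 - q i)
    (hother : ∀ i ∈ Finset.Icc 1 N, ∀ j ≤ N + 1, j ≠ i + 1 → j ≠ i - 1 → P i j = 0)
    (hh0 : h 0 = 0) (hh1 : h 1 = 1) (hhpos : ∀ i ≤ N + 1, 0 ≤ h i) (hhN : 0 < h (N + 1))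
    (hharm : ∀ i ∈ Finset.Icc 1 N, q i * h (i + 1) + (1 - q i) * h (i - 1) = h i)
    (hδ : 0 < δ) (hg : ∀ i, 0 ≤ g i)
    (hdrift : ∀ i ∈ Finset.Icc 1 N, q i * g (i + 1) + (1 - q i) * g (i - 1) + δ ≤ g i) :
    Tendsto (fun n => ∑ m ∈ Finset.range n, x m (N + 1)) atTop (nhds (1 / h (N + 1))) ∧
    Tendsto (fun n => ∑ m ∈ Finset.range n, x m 0) atTop (nhds (1 - 1 / h (N + 1))) := by
  have hstep : ∀ i ∈ Finset.Icc 1 N, ∀ f : ℕ → ℝ,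
      ∑ j ∈ Finset.range (N + 2), P i j * f j = q i * f (i + 1) + (1 - q i) * f (i - 1) := by
    intro i hi f
    have hi' := Finset.mem_Icc.1 hi
    rw [← hdown i hi, ← hup i hi]
    refine Finset.sum_eq_add_of_mem (i + 1) (i - 1) ?_ ?_ (by omega) ?_
    · simp; omega
    · simp; omega
    · intro j hj hne
      rw [hother i hi j (by have := Finset.mem_range.1 hj; omega) hne.1 hne.2, zero_mul]
  have hsplit : ∀ f : ℕ → ℝ, ∑ j ∈ Finset.range (N + 2), f j =
      f 0 + ∑ j ∈ Finset.Icc 1 N, f j + f (N + 1) := by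
    intro f
    rw [Finset.sum_range_succ, Finset.range_eq_Ico, Finset.sum_eq_sum_Ico_succ_bot (by omega)]
    rfl
  have hmain : ∀ n (f : ℕ → ℝ),
      x (n + 1) 0 * f 0 + ∑ i ∈ Finset.Icc 1 N, x (n + 1) i * f i + x (n + 1) (N + 1) * f (N + 1) =
        ∑ i ∈ Finset.Icc 1 N, x n i * (q i * f (i + 1) + (1 - q i) * f (i - 1)) := by
    intro n f
    rw [← hsplit (fun j => x (n + 1) j * f j)]
    calc ∑ j ∈ Finset.range (N + 2), x (n + 1) j * f j
        = ∑ j ∈ Finset.range (N + 2), ∑ i ∈ Finset.Icc 1 N, x n i * (P i j * f j) := by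
          refine Finset.sum_congr rfl fun j hj => ?_
          rw [hrec n j (by have := Finset.mem_range.1 hj; omega), Finset.sum_mul]
          exact Finset.sum_congr rfl fun i _ => by ring
      _ = _ := by
          rw [Finset.sum_comm]
          exact Finset.sum_congr rfl fun i hi => by rw [← Finset.mul_sum, hstep i hi f]
  have hinit : ∀ f : ℕ → ℝ, ∑ i ∈ Finset.Icc 1 N, x 0 i * f i = f 1 := by
    intro f
    rw [Finset.sum_eq_single_of_mem 1 (by simp [hN]) fun j _ hj => by rw [hx0 j hj, zero_mul],
      hx1, one_mul]
  set M : ℕ → (ℕ → ℝ) → ℝ := fun n f => ∑ i ∈ Finset.Icc 1 N, x n i * f i with hM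
  have hMnn : ∀ n f, (∀ i ∈ Finset.Icc 1 N, 0 ≤ f i) → 0 ≤ M n f := fun n f hf =>
    Finset.sum_nonneg fun i hi => mul_nonneg (hx n i) (hf i hi)
  have hS0 : Tendsto (fun n => M n fun _ => 1) atTop (nhds 0) := by
    refine tendsto_zero_of_drift hδ (fun n => hMnn n _ fun _ _ => zero_le_one)
      (fun n => hMnn n g fun i _ => hg i) fun n => ?_
    have h1 := hmain n g
    have h2 : ∑ i ∈ Finset.Icc 1 N, x n i * (q i * g (i + 1) + (1 - q i) * g (i - 1)) +
        δ * M n (fun _ => 1) ≤ M n g := by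
      rw [hM, Finset.mul_sum, ← Finset.sum_add_distrib]
      refine Finset.sum_le_sum fun i hi => ?_
      linarith [mul_le_mul_of_nonneg_left (hdrift i hi) (hx n i)]
    have h3 := mul_nonneg (hx (n + 1) 0) (hg 0)
    have h4 := mul_nonneg (hx (n + 1) (N + 1)) (hg (N + 1))
    simp only [hM] at h1 h2 ⊢
    linarith
  have hSh : Tendsto (fun n => M n h) atTop (nhds 0) := by
    have hC := hS0.mul_const (∑ i ∈ Finset.Icc 1 N, h i)
    rw [zero_mul] at hC
    refine squeeze_zero (fun n => hMnn n h fun i hi => hhpos i ?_) (fun n => ?_) hC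
    · have := Finset.mem_Icc.1 hi; omega
    · rw [hM, Finset.sum_mul]
      refine Finset.sum_le_sum fun i hi => ?_
      rw [mul_one]
      refine mul_le_mul_of_nonneg_left ?_ (hx n i)
      refine Finset.single_le_sum (f := h) (fun j hj => hhpos j ?_) hi
      have := Finset.mem_Icc.1 hj; omega
  have hA : ∀ n, M n h + h (N + 1) * ∑ m ∈ Finset.range (n + 1), x m (N + 1) = 1 := by
    intro n
    induction n with
    | zero => simp [hM, hinit, hh1, hx0 (N + 1) (by omega)]
    | succ n ih =>
      have h1 := hmain n h
      have h2 : ∑ i ∈ Finset.Icc 1 N, x n i * (q i * h (i + 1) + (1 - q i) * h (i - 1)) =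
          ∑ i ∈ Finset.Icc 1 N, x n i * h i :=
        Finset.sum_congr rfl fun i hi => by rw [hharm i hi]
      rw [h2, hh0] at h1
      rw [Finset.sum_range_succ]
      simp only [hM] at ih ⊢
      linarith
  have hB : ∀ n, (M n fun _ => 1) + ∑ m ∈ Finset.range (n + 1), x m (N + 1) +
      ∑ m ∈ Finset.range (n + 1), x m 0 = 1 := by
    intro n
    induction n with
    | zero => simp only [hM, hinit]; simp [hx0 (N + 1) (by omega), hx0 0 (by omega)]
    | succ n ih =>
      have h1 := hmain n fun _ => 1
      simp only [mul_one, add_sub_cancel] at h1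
      rw [Finset.sum_range_succ, Finset.sum_range_succ (fun m => x m 0)]
      simp only [hM, mul_one] at ih ⊢
      linarith
  have hup' : Tendsto (fun n => ∑ m ∈ Finset.range (n + 1), x m (N + 1)) atTop
      (nhds (1 / h (N + 1))) := by
    have := (hSh.const_sub 1).div_const (h (N + 1))
    rw [sub_zero] at this
    refine this.congr fun n => ?_
    rw [div_eq_iff hhN.ne']
    linarith [hA n]
  refine ⟨(tendsto_add_atTop_iff_nat 1).1 hup', (tendsto_add_atTop_iff_nat 1).1 ?_⟩
  have := (hS0.const_sub 1).sub hup'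
  rw [sub_zero] at this
  exact this.congr fun n => by linarith [hB n]

/-- Vertices of the trap on the way from the anchor (index `0`) to the core (index `e + 2`). -/
def trapPath (d : ℤ) (e : ℕ) (i : ℕ) : V :=
  if i = 0 then (d, 0) else if i ≤ e + 1 then (d - i + 1, 1) else (d - e, 2)

lemma trapPath_injOn (d : ℤ) (e : ℕ) : Set.InjOn (trapPath d e) (Set.Iic (e + 2)) := by
  intro i hi j hj hij
  simp only [Set.mem_Iic] at hi hj
  unfold trapPath at hij
  split_ifs at hij <;> simp only [Prod.mk.injEq] at hij <;> omega

lemma mem_trapEdgesAt_trapPath {d : ℤ} {e c i : ℕ} (hi : i ∈ Finset.Icc 1 (e + 1)) (u : V) :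
    s(trapPath d e i, u) ∈ trapEdgesAt d 0 e c ↔
      u = trapPath d e (i + 1) ∨ u = trapPath d e (i - 1) := by
  obtain ⟨a, b⟩ := u
  rw [Finset.mem_Icc] at hi
  have hpi : trapPath d e i = (d - i + 1, 1) := by
    unfold trapPath; rw [if_neg (by omega), if_pos (by omega)]
  have hup : (a, b) = trapPath d e (i + 1) ↔
      (i = e + 1 ∧ a = d - e ∧ b = 2) ∨ (i ≤ e ∧ a = d - i ∧ b = 1) := by
    rw [trapPath, if_neg (by omega)]
    split_ifs <;> simp only [Prod.mk.injEq] <;> omega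
  have hdown : (a, b) = trapPath d e (i - 1) ↔
      (i = 1 ∧ a = d ∧ b = 0) ∨ (2 ≤ i ∧ a = d - i + 2 ∧ b = 1) := by
    unfold trapPath
    split_ifs <;> simp only [Prod.mk.injEq] <;> omega
  rw [hup, hdown, hpi]
  simp only [trapEdgesAt, Set.mem_union, Set.mem_insert_iff, Set.mem_singleton_iff,
    Set.mem_ofPred_eq, Sym2.eq_iff, Prod.mk.injEq]
  constructor
  · rintro (((h | h) | ⟨k, hk, h⟩) | ⟨k, hk, h⟩) <;> omega
  · rintro ((h | h) | (h | h))
    · exact Or.inl (Or.inl (Or.inr (by omega)))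
    · exact Or.inl (Or.inr ⟨e - i, by omega, Or.inr (by omega)⟩)
    · exact Or.inl (Or.inl (Or.inl (by omega)))
    · exact Or.inl (Or.inr ⟨e + 1 - i, by omega, Or.inl (by omega)⟩)

/-- Probability of stepping towards the core from the `i`-th vertex of the path. -/
def trapUp (β : ℝ) (i : ℕ) : ℝ := if i = 1 then 1 / 2 else 1 / (β + 1)

lemma transProb_trapPath {β : ℝ} (hβ : 1 < β) {d : ℤ} {e c i j : ℕ} (he : 1 ≤ e)
    (hi : i ∈ Finset.Icc 1 (e + 1)) (hj : j ≤ e + 2) :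
    transProb β (trapEdgesAt d 0 e c) (trapPath d e i) (trapPath d e j) =
      if j = i + 1 then trapUp β i else if j = i - 1 then 1 - trapUp β i else 0 := by
  have hi' := Finset.mem_Icc.1 hi
  have hinj : ∀ k ≤ e + 2, ∀ l ≤ e + 2, trapPath d e k = trapPath d e l ↔ k = l :=
    fun k hk l hl => (trapPath_injOn d e).eq_iff hk hl
  have hΛ : {u : V | s(trapPath d e i, u) ∈ trapEdgesAt d 0 e c} =
      {trapPath d e (i + 1), trapPath d e (i - 1)} := by
    ext u
    simp [mem_trapEdgesAt_trapPath hi]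
  have hcard : ({trapPath d e (i + 1), trapPath d e (i - 1)} : Set V).ncard = 2 :=
    Set.ncard_pair fun h => by
      have := (hinj _ (by omega) _ (by omega)).1 h
      omega
  unfold transProb
  rw [hΛ, hcard, if_neg ((Set.insert_nonempty _ _).ne_empty), mem_trapEdgesAt_trapPath hi,
    mem_trapEdgesAt_trapPath hi, hinj _ hj _ (by omega), hinj _ hj _ (by omega)]
  have hβ1 : β + 1 ≠ 0 := by linarith
  by_cases h1 : i = 1
  · subst h1
    have hr : ¬ ((((trapPath d e 1).1 + 1, (trapPath d e 1).2) : V) = trapPath d e (1 + 1) ∨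
        (((trapPath d e 1).1 + 1, (trapPath d e 1).2) : V) = trapPath d e (1 - 1)) := by
      simp [trapPath, he]
      omega
    rw [if_neg hr]
    unfold trapUp
    split_ifs <;> first | omega | norm_num
  · have hr : (((trapPath d e i).1 + 1, (trapPath d e i).2) : V) = trapPath d e (i - 1) := by
      unfold trapPath
      rw [if_neg (by omega), if_pos (by omega), if_neg (by omega), if_pos (by omega)]
      simp only [Prod.mk.injEq, and_true]
      omega
    simp only [hr, or_true, if_true, hinj _ hj (i - 1) (by omega)]
    unfold trapUp
    split_ifs <;> first | omega | (push_cast; grind)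

/-- The harmonic function of the walk along `trapPath`, normalised to be `0` at the anchor. -/
def trapHarm (β : ℝ) (i : ℕ) : ℝ := if i = 0 then 0 else 1 + (β ^ (i - 1) - 1) / (β - 1)

lemma trapHarm_harmonic {β : ℝ} (hβ : 1 < β) {i : ℕ} (hi : 1 ≤ i) :
    trapUp β i * trapHarm β (i + 1) + (1 - trapUp β i) * trapHarm β (i - 1) = trapHarm β i := by
  have h1 : β - 1 ≠ 0 := by linarith
  have h2 : β + 1 ≠ 0 := by linarith
  obtain ⟨k, rfl⟩ := Nat.exists_eq_add_of_le' hi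
  rcases k with _ | k
  · simp [trapUp, trapHarm, h1]
    norm_num
  · simp only [trapUp, trapHarm, Nat.add_sub_cancel]
    simp only [Nat.add_eq_zero_iff, one_ne_zero, and_false, if_false, Nat.add_eq_right]
    field_simp
    ring

/-- Lemma 2.2. The β-biased walk started at `(d,1)` on the trap with anchor `(d,0)`,
entrance length `e` and core length `c` reaches the core vertex `(d-e,2)` before the anchor
`(d,0)` with probability exactly `(β-1)/(β^{e+1}+β-2)`. -/
theorem hit_the_core (β : ℝ) (hβ : 1 < β) (d : ℤ) (e c : ℕ) (he : 1 ≤ e) (hc : 1 ≤ c)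
    (μ : Measure (ℕ → V)) (hμ : IsWalkLaw β (trapEdgesAt d 0 e c) ((d, 1) : V) μ) :
    μ {ω | VisitsBefore ω ((d - e, 2) : V) ((d, 0) : V)} =
      ENNReal.ofReal ((β - 1) / (β ^ (e + 1) + β - 2)) := by
  have := hμ.1
  have hβ1 : 0 < β - 1 := by linarith
  set I := Finset.Icc 1 (e + 1) with hI
  set p := trapPath d e with hp
  have hIsub : (I : Set ℕ) ⊆ Set.Iic (e + 2) := fun i hi => by
    simp only [hI, Finset.coe_Icc, Set.mem_Icc, Set.mem_Iic] at hi ⊢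
    omega
  have hinj := trapPath_injOn d e
  have hp1 : p 1 = (d, 1) := by simp [hp, trapPath]
  have hp0 : p 0 = (d, 0) := by simp [hp, trapPath]
  have hpe : p (e + 2) = (d - e, 2) := by simp [hp, trapPath]
  have hnot : ∀ k ≤ e + 2, k ∉ I → p k ∉ p '' (I : Set ℕ) := by
    rintro k hk hkI ⟨i, hi, hik⟩
    exact hkI (hinj (hIsub hi) hk hik ▸ hi)
  let x : ℕ → ℕ → ℝ := fun n j => if j ≤ e + 2 then μ.real (stayThenAt (p '' I) n (p j)) else 0
  have hpos : 0 < trapHarm β (e + 1 + 1) := by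
    have := one_le_pow₀ hβ.le (n := e + 1)
    have : 0 ≤ (β ^ (e + 1) - 1) / (β - 1) := div_nonneg (by linarith) hβ1.le
    simp only [trapHarm, Nat.add_sub_cancel]
    rw [if_neg (by omega)]
    linarith
  have hruin := tendsto_ruin (N := e + 1) (x := x)
    (P := fun i j => transProb β (trapEdgesAt d 0 e c) (p i) (p j))
    (q := trapUp β) (h := trapHarm β) (g := fun i => if i = 0 then 0 else (i : ℝ) + 1)
    (δ := min (1 / 2) ((β - 1) / (β + 1))) (by omega)
    (fun n j => by simp only [x]; split_ifs <;> positivity)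
    (by simp [x, stayThenAt, hp1, measureReal_def, hμ.measure_start])
    (fun j hj => by
      simp only [x]
      split_ifs with hje
      · have hne : p j ≠ (d, 1) := fun h =>
          hj (hinj hje (Set.mem_Iic.2 (by omega)) (h.trans hp1.symm))
        rw [measureReal_eq_zero_iff]
        refine measure_mono_null (fun ω hω => ?_) hμ.measure_start_ne
        exact hω.1.trans_ne hne
      · rfl)
    (fun n j hj => by
      simp only [x]
      rw [if_pos hj, hμ.measureReal_stayThenAt_succ hβ.le (hinj.mono hIsub)]
      exact Finset.sum_congr rfl fun i hi => by
        rw [if_pos (show i ≤ e + 2 from hIsub hi)])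
    (fun i hi => by
      rw [transProb_trapPath hβ he hi (by have := Finset.mem_Icc.1 hi; omega), if_pos rfl])
    (fun i hi => by
      have := Finset.mem_Icc.1 hi
      rw [transProb_trapPath hβ he hi (by omega), if_neg (by omega), if_pos rfl])
    (fun i hi j hj h1 h2 => by rw [transProb_trapPath hβ he hi hj, if_neg h1, if_neg h2])
    (by simp [trapHarm]) (by simp [trapHarm])
    (fun i _ => by
      have := one_le_pow₀ hβ.le (n := i - 1)
      have : 0 ≤ (β ^ (i - 1) - 1) / (β - 1) := div_nonneg (by linarith) hβ1.le
      unfold trapHarm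
      split_ifs <;> linarith)
    hpos
    (fun i hi => trapHarm_harmonic hβ (Finset.mem_Icc.1 hi).1)
    (lt_min (by norm_num) (div_pos hβ1 (by linarith)))
    (fun i => by split_ifs <;> positivity)
    (fun i hi => by
      obtain ⟨k, rfl⟩ := Nat.exists_eq_add_of_le' (Finset.mem_Icc.1 hi).1
      rcases k with _ | k
      · have := min_le_left (1 / 2 : ℝ) ((β - 1) / (β + 1))
        simp only [trapUp, zero_add, Nat.sub_self, if_true, one_ne_zero, if_false, Nat.reduceAdd,
          OfNat.ofNat_ne_zero, Nat.cast_ofNat, Nat.cast_one]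
        linarith
      · have hm := min_le_right (1 / 2 : ℝ) ((β - 1) / (β + 1))
        simp only [trapUp, Nat.add_sub_cancel, Nat.add_eq_zero_iff, one_ne_zero, and_false,
          if_false, Nat.add_eq_right]
        have hkey : 1 / (β + 1) * (((k + 1 + 1 + 1 : ℕ) : ℝ) + 1) +
            (1 - 1 / (β + 1)) * (((k + 1 : ℕ) : ℝ) + 1) + (β - 1) / (β + 1) =
            ((k + 1 + 1 : ℕ) : ℝ) + 1 := by
          have : β + 1 ≠ 0 := by linarith
          push_cast
          field_simp
          ring
        linarith)
  have hab : ((d - e, 2) : V) ≠ (d, 0) := by simp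
  have h0K : ((d, 0) : V) ∉ p '' (I : Set ℕ) := hp0 ▸ hnot 0 (by omega) (by simp [hI])
  have heK : ((d - e, 2) : V) ∉ p '' (I : Set ℕ) := hpe ▸ hnot (e + 2) le_rfl (by simp [hI])
  have hlow : 1 / trapHarm β (e + 1 + 1) ≤
      μ.real {ω | VisitsBefore ω ((d - e, 2) : V) ((d, 0) : V)} := by
    refine le_of_tendsto' hruin.1 fun n => ?_
    simpa [x, hpe] using sum_measureReal_stayThenAt_le (μ := μ) heK h0K hab n
  have hlow' : 1 - 1 / trapHarm β (e + 1 + 1) ≤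
      μ.real {ω | VisitsBefore ω ((d, 0) : V) ((d - e, 2) : V)} := by
    refine le_of_tendsto' hruin.2 fun n => ?_
    simpa [x, hp0] using sum_measureReal_stayThenAt_le (μ := μ) h0K heK hab.symm n
  have hsum : μ.real {ω | VisitsBefore ω ((d - e, 2) : V) ((d, 0) : V)} +
      μ.real {ω | VisitsBefore ω ((d, 0) : V) ((d - e, 2) : V)} ≤ 1 := by
    rw [← measureReal_union (disjoint_visitsBefore _ _) (measurableSet_visitsBefore _ _)]
    exact measureReal_le_one
  have hval : (β - 1) / (β ^ (e + 1) + β - 2) = 1 / trapHarm β (e + 1 + 1) := by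
    have : trapHarm β (e + 1 + 1) = (β ^ (e + 1) + β - 2) / (β - 1) := by
      simp only [trapHarm, Nat.add_sub_cancel]
      rw [if_neg (by omega)]
      field_simp
      ring
    rw [this, one_div_div]
  rw [hval, ← ofReal_measureReal]
  congr 1
  linarith

end
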